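/- arXiv:1911.07910 — 6 statements merged into one kernel-verified Lean document; each statement's English description precedes it below -/
import Mathlib

section
/- For every finite set X with |X| ≥ 2, every ε > 0, and every natural number d with d ≥ 8·ln(|X|)/ε², there exists a map φ : X → ℝ^d (Euclidean space) such that ‖φ(x)‖₂ = 1 for every x ∈ X, and |⟨φ(x), φ(y)⟩| ≤ ε for all x, y ∈ X with x ≠ y. -/
open scoped RealInnerProductSpace

/-- The sign `±1` encoded by a Boolean. -/
def boolSign (b : Bool) : ℝ := if b then 1 else -1

lemma boolSign_mul_self (b : Bool) : boolSign b * boolSign b = 1 := by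
  cases b <;> simp [boolSign]

/-- The unnormalized correlation of two sign vectors. -/
def signCorr {ι : Type*} [Fintype ι] (s t : ι → Bool) : ℝ := ∑ i, boolSign (s i) * boolSign (t i)

lemma signCorr_comm {ι : Type*} [Fintype ι] (s t : ι → Bool) : signCorr s t = signCorr t s :=
  Finset.sum_congr rfl fun _ _ => mul_comm _ _

lemma sum_exp_mul_signCorr {ι : Type*} [Fintype ι] [DecidableEq ι] (c : ℝ) (t : ι → Bool) :
    ∑ s : ι → Bool, Real.exp (c * signCorr s t) = (2 * Real.cosh c) ^ Fintype.card ι := by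
  have h := Finset.prod_univ_sum (fun _ : ι => (Finset.univ : Finset Bool))
    (fun i b => Real.exp (c * (boolSign b * boolSign (t i))))
  simp only [Fintype.piFinset_univ, ← Real.exp_sum, ← Finset.mul_sum] at h
  simp only [signCorr]
  rw [← h, ← Finset.card_univ, ← Finset.prod_const]
  refine Finset.prod_congr rfl fun i _ => ?_
  cases t i <;> simp [boolSign, Real.cosh_eq] <;> ring

lemma sum_cosh_mul_signCorr {ι : Type*} [Fintype ι] [DecidableEq ι] (c : ℝ) (t : ι → Bool) :
    ∑ s : ι → Bool, Real.cosh (c * signCorr s t) = (2 * Real.cosh c) ^ Fintype.card ι := by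
  have h := sum_exp_mul_signCorr (-c) t
  simp only [Real.cosh_neg, neg_mul] at h
  simp only [Real.cosh_eq (_ * signCorr _ _)]
  rw [← Finset.sum_div, Finset.sum_add_distrib, h, sum_exp_mul_signCorr]
  ring

/-- Some sign vector is nearly orthogonal to each of a few given ones. -/
lemma exists_abs_signCorr_le {ι κ : Type*} [Fintype ι] [DecidableEq ι] (A : Finset κ)
    (t : κ → ι → Bool) {c : ℝ} (hc : 0 < c)
    (hA : 2 * (A.card : ℝ) ≤ Real.exp (Fintype.card ι * c ^ 2 / 2)) :
    ∃ s : ι → Bool, ∀ j ∈ A, |signCorr s (t j)| ≤ Fintype.card ι * c := by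
  set n := Fintype.card ι
  have havg : ∑ s : ι → Bool, ∑ j ∈ A, Real.cosh (c * signCorr s (t j)) ≤
      ∑ _s : ι → Bool, A.card * Real.exp (n * c ^ 2 / 2) := by
    rw [Finset.sum_comm]
    simp only [sum_cosh_mul_signCorr, Finset.sum_const, Finset.card_univ, Fintype.card_pi,
      Fintype.card_bool, Finset.prod_const, nsmul_eq_mul, mul_pow]
    have h : Real.cosh c ^ n ≤ Real.exp (n * c ^ 2 / 2) := by
      calc Real.cosh c ^ n ≤ Real.exp (c ^ 2 / 2) ^ n :=
            pow_le_pow_left₀ (Real.cosh_pos c).le (Real.cosh_le_exp_half_sq c) n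
        _ = Real.exp (n * c ^ 2 / 2) := by rw [← Real.exp_nat_mul, mul_div_assoc]
    push_cast
    calc (A.card : ℝ) * (2 ^ n * Real.cosh c ^ n)
        ≤ A.card * (2 ^ n * Real.exp (n * c ^ 2 / 2)) := by gcongr
      _ = 2 ^ n * (A.card * Real.exp (n * c ^ 2 / 2)) := by ring
  obtain ⟨s, -, hs⟩ := Finset.exists_le_of_sum_le Finset.univ_nonempty havg
  refine ⟨s, fun j hj => ?_⟩
  by_contra! hlt
  have h1 : Real.cosh (c * signCorr s (t j)) ≤ A.card * Real.exp (n * c ^ 2 / 2) :=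
    (Finset.single_le_sum (f := fun j => Real.cosh (c * signCorr s (t j)))
      (fun _ _ => (Real.cosh_pos _).le) hj).trans hs
  have h2 : Real.exp (n * c ^ 2) < 2 * Real.cosh (c * signCorr s (t j)) := by
    rw [← Real.cosh_abs, abs_mul, abs_of_pos hc, Real.cosh_eq]
    have h3 : Real.exp (n * c ^ 2) < Real.exp (c * |signCorr s (t j)|) := by
      apply Real.exp_lt_exp.2
      nlinarith
    linarith [Real.exp_pos (-(c * |signCorr s (t j)|))]
  have h4 : Real.exp (n * c ^ 2) = Real.exp (n * c ^ 2 / 2) * Real.exp (n * c ^ 2 / 2) := by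
    rw [← Real.exp_add, add_halves]
  nlinarith [Real.exp_pos (n * c ^ 2 / 2)]

/-- Greedy construction of a family of nearly orthogonal sign vectors. -/
lemma exists_pairwise_abs_signCorr_le {ι κ : Type*} [Fintype ι] (A : Finset κ) {c : ℝ}
    (hc : 0 < c) (hA : 2 * (A.card : ℝ) ≤ Real.exp (Fintype.card ι * c ^ 2 / 2)) :
    ∃ t : κ → ι → Bool, (A : Set κ).Pairwise fun x y =>
      |signCorr (t x) (t y)| ≤ Fintype.card ι * c := by
  classical
  induction A using Finset.induction_on with
  | empty => exact ⟨fun _ _ => true, by simp⟩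
  | insert a A ha ih =>
    have hA' : 2 * (A.card : ℝ) ≤ Real.exp (Fintype.card ι * c ^ 2 / 2) := by
      rw [Finset.card_insert_of_notMem ha] at hA
      push_cast at hA
      linarith
    obtain ⟨t, ht⟩ := ih hA'
    obtain ⟨s, hs⟩ := exists_abs_signCorr_le A t hc hA'
    have hne : ∀ x ∈ A, x ≠ a := fun x hx h => ha (h ▸ hx)
    refine ⟨Function.update t a s, ?_⟩
    rw [Finset.coe_insert, Set.pairwise_insert]
    refine ⟨fun x hx y hy hxy => ?_, fun x hx _ => ?_⟩
    · simpa [hne x hx, hne y hy] using ht hx hy hxy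
    · have := hs x hx
      simp [hne x hx, signCorr_comm (t x) s, this]

/-- For every finite set `X` with `|X| ≥ 2`, every `ε > 0`, and every natural number `d`
with `d ≥ 8 ln |X| / ε²`, there is a map `φ : X → ℝ^d` with unit-norm values whose
pairwise inner products are at most `ε` in absolute value. -/
theorem stmt_0 (X : Type*) [Fintype X] (hX : 2 ≤ Fintype.card X)
    (ε : ℝ) (hε : 0 < ε) (d : ℕ)
    (hd : 8 * Real.log (Fintype.card X) / ε ^ 2 ≤ (d : ℝ)) :
    ∃ φ : X → EuclideanSpace ℝ (Fin d),
      (∀ x, ‖φ x‖ = 1) ∧ ∀ x y : X, x ≠ y → |⟪φ x, φ y⟫| ≤ ε := by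
  have hN : (2 : ℝ) ≤ Fintype.card X := by exact_mod_cast hX
  have hlog : 0 < Real.log (Fintype.card X) := Real.log_pos (by linarith)
  have hd0 : (0 : ℝ) < d := lt_of_lt_of_le (by positivity) hd
  rw [div_le_iff₀ (by positivity)] at hd
  have hexp : 2 * ((Finset.univ : Finset X).card : ℝ) ≤
      Real.exp (Fintype.card (Fin d) * ε ^ 2 / 2) := by
    rw [Finset.card_univ, Fintype.card_fin]
    calc 2 * (Fintype.card X : ℝ) ≤ Fintype.card X * Fintype.card X := by gcongr
      _ = Real.exp (Real.log (Fintype.card X) + Real.log (Fintype.card X)) := by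
        rw [Real.exp_add, Real.exp_log (by linarith)]
      _ ≤ Real.exp (d * ε ^ 2 / 2) := Real.exp_le_exp.2 (by linarith)
  obtain ⟨t, ht⟩ := exists_pairwise_abs_signCorr_le (ι := Fin d) Finset.univ hε hexp
  let φ : X → EuclideanSpace ℝ (Fin d) := fun x =>
    (√(d : ℝ))⁻¹ • WithLp.toLp 2 fun i => boolSign (t x i)
  have hinner (x y : X) : ⟪φ x, φ y⟫ = signCorr (t x) (t y) / d := by
    have h : (√(d : ℝ))⁻¹ * (√(d : ℝ))⁻¹ = (d : ℝ)⁻¹ := by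
      rw [← mul_inv, Real.mul_self_sqrt hd0.le]
    simp only [φ, real_inner_smul_left, real_inner_smul_right, ← mul_assoc, h]
    rw [real_inner_comm, PiLp.inner_apply, div_eq_inv_mul]
    rfl
  refine ⟨φ, fun x => ?_, fun x y hxy => ?_⟩
  · have h : ‖φ x‖ ^ 2 = 1 := by
      rw [← real_inner_self_eq_norm_sq, hinner]
      simp [signCorr, boolSign_mul_self, hd0.ne']
    exact (pow_eq_one_iff_of_nonneg (norm_nonneg _) two_ne_zero).1 h
  · rw [hinner, abs_div, abs_of_pos hd0, div_le_iff₀ hd0, mul_comm]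
    simpa using ht (by simp) (by simp) hxy
end

section
/- For every finite set X with |X| ≥ 2, every ε > 0, and every natural number d with d ≥ 8·ln(|X|)/ε², there exists a map φ : X → ℝ^d such that for every z ∈ X there is θ ∈ ℝ^d with ‖θ‖₂ ≤ 1 and sup_{x ∈ X} |f_z(x) − ⟨θ, φ(x)⟩| ≤ ε; that is, max over the class of all one-hot functions on X of the best sup-norm linear approximation error with coefficient norm at most 1 is at most ε. -/
open scoped RealInnerProductSpace

/-- The sign vectors in `ℝ^d`. -/
noncomputable def signVectors (d : ℕ) : Finset (Fin d → ℝ) :=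
  Fintype.piFinset fun _ => {1, -1}

theorem eq_one_or_of_mem_signVectors {d : ℕ} {v : Fin d → ℝ} (hv : v ∈ signVectors d)
    (i : Fin d) : v i = 1 ∨ v i = -1 := by
  simpa using Fintype.mem_piFinset.1 hv i

theorem card_signVectors (d : ℕ) : (signVectors d).card = 2 ^ d := by
  have h : ({1, -1} : Finset ℝ).card = 2 := Finset.card_pair (by norm_num)
  simp [signVectors, h]

theorem signVectors_nonempty (d : ℕ) : (signVectors d).Nonempty := by
  simp [← Finset.card_pos, card_signVectors]

theorem sum_signVectors_exp {d : ℕ} (t : ℝ) {v : Fin d → ℝ} (hv : v ∈ signVectors d) :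
    ∑ u ∈ signVectors d, Real.exp (t * ∑ i, u i * v i) = (2 * Real.cosh t) ^ d := by
  have h (i : Fin d) :
      ∑ s ∈ ({1, -1} : Finset ℝ), Real.exp (t * (s * v i)) = 2 * Real.cosh t := by
    rw [Finset.sum_pair (by norm_num), Real.cosh_eq]
    rcases eq_one_or_of_mem_signVectors hv i with h | h <;> simp [h] <;> ring
  simp_rw [Finset.mul_sum, Real.exp_sum, signVectors]
  rw [← Finset.prod_univ_sum (fun _ => ({1, -1} : Finset ℝ))
    (fun i s => Real.exp (t * (s * v i)))]
  simp [h]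

theorem sum_signVectors_cosh_le {d : ℕ} (t : ℝ) {v : Fin d → ℝ} (hv : v ∈ signVectors d) :
    ∑ u ∈ signVectors d, Real.cosh (t * ∑ i, u i * v i)
      ≤ 2 ^ d * Real.exp (d * (t ^ 2 / 2)) := by
  have h : ∑ u ∈ signVectors d, Real.cosh (t * ∑ i, u i * v i) = (2 * Real.cosh t) ^ d := by
    simp_rw [Real.cosh_eq, ← Finset.sum_div, Finset.sum_add_distrib, ← neg_mul,
      sum_signVectors_exp _ hv, Real.cosh_neg, Real.cosh_eq]
    ring
  rw [h, mul_pow, Real.exp_nat_mul]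
  have := Real.cosh_pos t
  gcongr
  exact Real.cosh_le_exp_half_sq t

/-- Any family of sign vectors admits a further sign vector nearly orthogonal to all of them. -/
theorem exists_signVector_abs_sum_mul_le {ι : Type*} {d : ℕ} (S : Finset ι) {V : ι → Fin d → ℝ}
    (hV : ∀ x, V x ∈ signVectors d) {t : ℝ} (ht : 0 < t) :
    ∃ u ∈ signVectors d, ∀ x ∈ S,
      t * |∑ i, u i * V x i| ≤ Real.log (2 * S.card) + d * (t ^ 2 / 2) := by
  obtain ⟨u, hu, hle⟩ : ∃ u ∈ signVectors d,
      ∑ x ∈ S, Real.cosh (t * ∑ i, u i * V x i) ≤ S.card * Real.exp (d * (t ^ 2 / 2)) := by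
    apply Finset.exists_le_of_sum_le (signVectors_nonempty d)
    rw [Finset.sum_comm, Finset.sum_const, card_signVectors, nsmul_eq_mul]
    calc _ ≤ ∑ x ∈ S, (2 : ℝ) ^ d * Real.exp (d * (t ^ 2 / 2)) :=
          Finset.sum_le_sum fun x _ => sum_signVectors_cosh_le t (hV x)
      _ = _ := by
          rw [Finset.sum_const, nsmul_eq_mul]
          push_cast
          ring
  refine ⟨u, hu, fun x hx => ?_⟩
  have hS : (0 : ℝ) < S.card := by exact_mod_cast Finset.card_pos.2 ⟨x, hx⟩
  have hx_le := (Finset.single_le_sum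
    (f := fun x => Real.cosh (t * ∑ i, u i * V x i))
    (fun y _ => (Real.cosh_pos _).le) hx).trans hle
  rw [← Real.cosh_abs, abs_mul, abs_of_pos ht, Real.cosh_eq] at hx_le
  rw [← Real.exp_le_exp, Real.exp_add, Real.exp_log (by positivity)]
  have := Real.exp_pos (-(t * |∑ i, u i * V x i|))
  linarith

theorem exists_signVectors_pairwise_abs_sum_mul_le {X : Type*} [DecidableEq X] {d : ℕ} {t : ℝ}
    (ht : 0 < t) (S : Finset X) :
    ∃ V : X → Fin d → ℝ, (∀ x, V x ∈ signVectors d) ∧ ∀ x ∈ S, ∀ z ∈ S, x ≠ z →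
      t * |∑ i, V x i * V z i| ≤ Real.log (2 * S.card) + d * (t ^ 2 / 2) := by
  induction S using Finset.induction_on with
  | empty =>
    obtain ⟨v, hv⟩ := signVectors_nonempty d
    exact ⟨fun _ => v, fun _ => hv, by simp⟩
  | insert a S ha ih =>
    obtain ⟨V, hV, hpair⟩ := ih
    obtain ⟨u, hu, hnew⟩ := exists_signVector_abs_sum_mul_le S hV ht
    have hmono {x : X} (hx : x ∈ S) :
        Real.log (2 * S.card) ≤ Real.log (2 * (insert a S).card) := by
      have : (0 : ℝ) < S.card := by exact_mod_cast Finset.card_pos.2 ⟨x, hx⟩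
      gcongr
      exact Finset.subset_insert a S
    have hne {x : X} (hx : x ∈ S) : x ≠ a := fun h => ha (h ▸ hx)
    refine ⟨Function.update V a u, fun x => ?_, fun x hx z hz hxz => ?_⟩
    · by_cases h : x = a
      · subst h
        simpa using hu
      · simpa [h] using hV x
    · rcases Finset.mem_insert.1 hx with rfl | hxS <;> rcases Finset.mem_insert.1 hz with rfl | hzS
      · exact absurd rfl hxz
      · simpa [hne hzS] using (hnew z hzS).trans (add_le_add_left (hmono hzS) _)
      · simpa [hne hxS, mul_comm (u _)] using
          (hnew x hxS).trans (add_le_add_left (hmono hxS) _)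
      · simpa [hne hxS, hne hzS] using
          (hpair x hxS z hzS hxz).trans (add_le_add_left (hmono hxS) _)

/-- For every finite set `X` with `|X| ≥ 2`, every `ε > 0`, and every `d ≥ 8 ln |X| / ε²`,
there is a feature map `φ : X → ℝ^d` such that every one-hot function on `X` is
approximated in sup norm to accuracy `ε` by some linear function with coefficient
vector of norm at most `1`. -/
theorem stmt_2 (X : Type*) [Fintype X] [DecidableEq X] (hX : 2 ≤ Fintype.card X)
    (ε : ℝ) (hε : 0 < ε) (d : ℕ)
    (hd : 8 * Real.log (Fintype.card X) / ε ^ 2 ≤ (d : ℝ)) :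
    ∃ φ : X → EuclideanSpace ℝ (Fin d),
      ∀ z : X, ∃ θ : EuclideanSpace ℝ (Fin d), ‖θ‖ ≤ 1 ∧
        ∀ x : X, |(if x = z then (1 : ℝ) else 0) - ⟪θ, φ x⟫| ≤ ε := by
  obtain ⟨V, hV, hpair⟩ :=
    exists_signVectors_pairwise_abs_sum_mul_le (d := d) hε (Finset.univ : Finset X)
  have hn : (2 : ℝ) ≤ Fintype.card X := by exact_mod_cast hX
  have hlog : 0 < Real.log (Fintype.card X) := Real.log_pos (by linarith)
  have hd0 : (0 : ℝ) < d := lt_of_lt_of_le (by positivity) hd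
  have hlog_two : Real.log (2 * Fintype.card X) ≤ 2 * Real.log (Fintype.card X) := by
    rw [Real.log_mul two_ne_zero (by positivity)]
    linarith [Real.log_le_log two_pos hn]
  rw [div_le_iff₀ (by positivity)] at hd
  set φ : X → EuclideanSpace ℝ (Fin d) := fun x => WithLp.toLp 2 fun i => V x i / √d with hφ
  have hinner (z x : X) : ⟪φ z, φ x⟫ = (∑ i, V x i * V z i) / d := by
    simp only [hφ, PiLp.inner_apply, RCLike.inner_apply, conj_trivial, Finset.sum_div]
    refine Finset.sum_congr rfl fun i _ => ?_
    rw [div_mul_div_comm, Real.mul_self_sqrt hd0.le]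
  have hself (z : X) : ⟪φ z, φ z⟫ = 1 := by
    have h (i : Fin d) : V z i * V z i = 1 := by
      rcases eq_one_or_of_mem_signVectors (hV z) i with h | h <;> simp [h]
    rw [hinner]
    simp [h, hd0.ne']
  refine ⟨φ, fun z => ⟨φ z, ?_, fun x => ?_⟩⟩
  · rw [norm_eq_sqrt_real_inner, hself, Real.sqrt_one]
  · by_cases hxz : x = z
    · subst hxz
      rw [hself]
      simp [hε.le]
    · have h := hpair x (Finset.mem_univ x) z (Finset.mem_univ z) hxz
      rw [Finset.card_univ] at h
      rw [if_neg hxz, zero_sub, abs_neg, hinner, abs_div, abs_of_pos hd0, div_le_iff₀ hd0]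
      refine le_of_mul_le_mul_left ?_ hε
      nlinarith
end

section
/- Fix ε > 0, ε' ∈ [0, 1), a finite set X with |X| ≥ 2, and a natural number d with d ≥ 8·ln(|X|)/ε². Then there exists a feature map φ : X → ℝ^d such that: (i) for every z ∈ X there is θ ∈ ℝ^d with ‖θ‖₂ ≤ 1 and sup_{x ∈ X} |f_z(x) − ⟨θ, φ(x)⟩| ≤ ε; and (ii) for every deterministic adaptive strategy A : List ℝ → X there exists z ∈ X such that in the run of A against f_z (where x_k = A([y_1,…,y_k]) and y_{k+1} = f_z(x_k)), none of the first |X| − 1 actions x_0, …, x_{|X|−2} is ε'-optimal for f_z. Consequently, at least |X| − 1 trials can be necessary to identify an ε'-optimal action even though the rewards admit an ε-accurate linear approximation with these features. -/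
open scoped RealInnerProductSpace

/-- The moment generating function of a Rademacher sum, as a sum over all sign vectors. -/
theorem sum_exp_signs {d : ℕ} (t : ℝ) (u : Fin d → ℤˣ) :
    ∑ v : Fin d → ℤˣ, Real.exp (t * ∑ i, (((u i : ℤ) : ℝ) * ((v i : ℤ) : ℝ))) =
      (2 * Real.cosh t) ^ d := by
  have h : ∀ a : ℤˣ, ∑ b : ℤˣ, Real.exp (t * (((a : ℤ) : ℝ) * ((b : ℤ) : ℝ))) =
      2 * Real.cosh t := by
    intro a
    have hu : (Finset.univ : Finset ℤˣ) = {1, -1} := rfl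
    rw [hu, Finset.sum_pair (by decide), Real.cosh_eq]
    rcases Int.units_eq_one_or a with rfl | rfl <;> simp <;> ring
  simp_rw [Finset.mul_sum, Real.exp_sum]
  rw [← Fintype.piFinset_univ, ← Finset.prod_univ_sum (fun _ => Finset.univ)
    (fun i (b : ℤˣ) => Real.exp (t * (((u i : ℤ) : ℝ) * ((b : ℤ) : ℝ))))]
  simp only [h, Finset.prod_const, Finset.card_univ, Fintype.card_fin]

/-- If `2 |S| ≤ exp (d ε² / 2)`, some sign vector has inner product at most `ε d` in absolute
value with each of the sign vectors `u x`, `x ∈ S`. -/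
theorem exists_sign_vector_almost_orthogonal {X : Type*} {d : ℕ} {ε : ℝ} (hε : 0 ≤ ε)
    (S : Finset X) (hS : 2 * (S.card : ℝ) ≤ Real.exp (d * ε ^ 2 / 2)) (u : X → Fin d → ℤˣ) :
    ∃ v : Fin d → ℤˣ, ∀ x ∈ S,
      |∑ i, (((u x i : ℤ) : ℝ) * ((v i : ℤ) : ℝ))| ≤ ε * d := by
  set p : X → (Fin d → ℤˣ) → ℝ := fun x v => ∑ i, (((u x i : ℤ) : ℝ) * ((v i : ℤ) : ℝ))
  set F : (Fin d → ℤˣ) → ℝ := fun v =>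
    ∑ x ∈ S, (Real.exp (ε * p x v) + Real.exp (-ε * p x v))
  have htot : ∑ v, F v = ∑ _v : Fin d → ℤˣ, 2 * (S.card : ℝ) * Real.cosh ε ^ d := by
    simp only [F, p]
    rw [Finset.sum_comm]
    simp only [Finset.sum_add_distrib, sum_exp_signs, Real.cosh_neg]
    simp only [Finset.sum_const, Finset.card_univ, Fintype.card_fun, Fintype.card_units_int,
      Fintype.card_fin, nsmul_eq_mul]
    push_cast
    ring
  obtain ⟨v, -, hv⟩ := Finset.exists_le_of_sum_le Finset.univ_nonempty htot.le
  refine ⟨v, fun x hx => ?_⟩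
  have hterm : Real.exp (ε * p x v) + Real.exp (-ε * p x v) ≤ F v :=
    Finset.single_le_sum (f := fun x => Real.exp (ε * p x v) + Real.exp (-ε * p x v))
      (fun _ _ => by positivity) hx
  have hcosh : Real.cosh ε ^ d ≤ Real.exp (d * ε ^ 2 / 2) := by
    calc Real.cosh ε ^ d ≤ Real.exp (ε ^ 2 / 2) ^ d :=
          pow_le_pow_left₀ (Real.cosh_pos ε).le (Real.cosh_le_exp_half_sq ε) d
      _ = Real.exp (d * ε ^ 2 / 2) := by rw [← Real.exp_nat_mul]; ring_nf
  have hbound : Real.exp (ε * p x v) + Real.exp (-ε * p x v) ≤ Real.exp (ε * (ε * d)) := by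
    calc _ ≤ 2 * (S.card : ℝ) * Real.cosh ε ^ d := hterm.trans hv
      _ ≤ Real.exp (d * ε ^ 2 / 2) * Real.exp (d * ε ^ 2 / 2) := by gcongr
      _ = Real.exp (ε * (ε * d)) := by rw [← Real.exp_add]; ring_nf
  rcases hε.eq_or_lt with rfl | hpos
  · norm_num at hbound
  have h₁ : ε * p x v < ε * (ε * d) := Real.exp_lt_exp.1 (by
    linarith [Real.exp_pos (-ε * p x v)])
  have h₂ : -ε * p x v < ε * (ε * d) := Real.exp_lt_exp.1 (by
    linarith [Real.exp_pos (ε * p x v)])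
  rw [abs_le]
  constructor
  · have : ε * (-p x v) < ε * (ε * d) := by linarith
    linarith [lt_of_mul_lt_mul_left this hε]
  · exact (lt_of_mul_lt_mul_left h₁ hε).le

/-- A finite family of pairwise almost orthogonal sign vectors. -/
theorem exists_almost_orthogonal_signs {X : Type*} [DecidableEq X] {d : ℕ} {ε : ℝ}
    (hε : 0 ≤ ε) (S : Finset X) (hS : 2 * (S.card : ℝ) ≤ Real.exp (d * ε ^ 2 / 2)) :
    ∃ u : X → Fin d → ℤˣ, ∀ x ∈ S, ∀ y ∈ S, x ≠ y →
      |∑ i, (((u x i : ℤ) : ℝ) * ((u y i : ℤ) : ℝ))| ≤ ε * d := by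
  induction S using Finset.induction_on with
  | empty => exact ⟨fun _ _ => 1, by simp⟩
  | insert a S ha ih =>
    have hS' : 2 * (S.card : ℝ) ≤ Real.exp (d * ε ^ 2 / 2) := by
      rw [Finset.card_insert_of_notMem ha] at hS
      push_cast at hS
      linarith
    obtain ⟨u, hu⟩ := ih hS'
    obtain ⟨v, hv⟩ := exists_sign_vector_almost_orthogonal hε S hS' u
    refine ⟨Function.update u a v, fun x hx y hy hxy => ?_⟩
    rcases Finset.mem_insert.1 hx with rfl | hxS <;> rcases Finset.mem_insert.1 hy with rfl | hyS
    · exact absurd rfl hxy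
    · simpa [Function.update_of_ne hxy.symm, mul_comm] using hv y hyS
    · simpa [Function.update_of_ne hxy] using hv x hxS
    · have hxa : x ≠ a := fun h => ha (h ▸ hxS)
      have hya : y ≠ a := fun h => ha (h ▸ hyS)
      simpa [Function.update_of_ne hxa, Function.update_of_ne hya] using hu x hxS y hyS hxy

/-- Unit vectors indexed by `X` whose Gram matrix is entrywise `ε`-close to the identity. -/
theorem exists_almost_orthonormal {X : Type*} [Fintype X] [DecidableEq X] {d : ℕ} {ε : ℝ}
    (hd₀ : 0 < d) (hε : 0 ≤ ε)
    (hX : 2 * (Fintype.card X : ℝ) ≤ Real.exp (d * ε ^ 2 / 2)) :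
    ∃ φ : X → EuclideanSpace ℝ (Fin d), (∀ x, ‖φ x‖ = 1) ∧
      ∀ z x, |(if x = z then (1 : ℝ) else 0) - ⟪φ z, φ x⟫| ≤ ε := by
  obtain ⟨u, hu⟩ := exists_almost_orthogonal_signs (d := d) hε (Finset.univ : Finset X) hX
  have hd : (0 : ℝ) < d := by exact_mod_cast hd₀
  set φ : X → EuclideanSpace ℝ (Fin d) := fun x =>
    WithLp.toLp 2 fun i => ((u x i : ℤ) : ℝ) / √d with hφ
  have hinner : ∀ z x, ⟪φ z, φ x⟫ = (∑ i, (((u z i : ℤ) : ℝ) * ((u x i : ℤ) : ℝ))) / d := by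
    intro z x
    simp only [hφ, PiLp.inner_apply, Finset.sum_div]
    refine Finset.sum_congr rfl fun i _ => ?_
    rw [Real.inner_apply, div_mul_div_comm, Real.mul_self_sqrt hd.le]
  have hself : ∀ x, ⟪φ x, φ x⟫ = 1 := by
    intro x
    have hsq : ∀ a : ℤˣ, ((a : ℤ) : ℝ) * ((a : ℤ) : ℝ) = 1 := fun a => by
      exact_mod_cast Int.units_coe_mul_self a
    rw [hinner]
    simp [hsq, hd.ne']
  refine ⟨φ, fun x => ?_, fun z x => ?_⟩
  · rw [norm_eq_sqrt_real_inner, hself, Real.sqrt_one]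
  · split_ifs with h
    · subst h
      rwa [hself, sub_self, abs_zero]
    · rw [zero_sub, abs_neg, hinner, abs_div, abs_of_pos hd, div_le_iff₀ hd]
      exact hu z (Finset.mem_univ _) x (Finset.mem_univ _) (Ne.symm h)

/-- An adaptive strategy run against one-hot functions misses some point for the first
`|X| - 1` rounds. -/
theorem exists_missed_point {X : Type*} [Fintype X] [DecidableEq X] [Nonempty X]
    (A : List ℝ → X) :
    ∃ z : X, ∀ (x : ℕ → X) (y : ℕ → ℝ),
      (∀ k : ℕ, x k = A (List.ofFn (fun i : Fin k => y (i + 1)))) →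
      (∀ k : ℕ, y (k + 1) = if x k = z then (1 : ℝ) else 0) →
      ∀ k < Fintype.card X - 1, x k ≠ z := by
  have hcard : ((Finset.range (Fintype.card X - 1)).image
      fun k => A (List.replicate k 0)).card < Fintype.card X := by
    refine Finset.card_image_le.trans_lt ?_
    have := Fintype.card_pos (α := X)
    simp only [Finset.card_range]
    omega
  obtain ⟨z, hz⟩ : ∃ z, z ∉ (Finset.range (Fintype.card X - 1)).image
      fun k => A (List.replicate k 0) := by
    by_contra! h
    exact hcard.ne (Finset.card_eq_iff_eq_univ _ |>.2 (Finset.eq_univ_iff_forall.2 h))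
  refine ⟨z, fun x y hx hy k => ?_⟩
  induction k using Nat.strong_induction_on with
  | _ k ih =>
    intro hk hxz
    have hzero : (fun i : Fin k => y (i + 1)) = fun _ => 0 := by
      funext i
      rw [hy, if_neg (ih i i.2 (i.2.trans hk))]
    rw [hx, hzero, List.ofFn_const] at hxz
    exact hz (Finset.mem_image.2 ⟨k, Finset.mem_range.2 hk, hxz⟩)

/-- Lower-bound construction: for `ε > 0`, `ε' ∈ [0,1)`, a finite set `X` with `|X| ≥ 2`
and `d ≥ 8 ln |X| / ε²`, there is a feature map `φ : X → ℝ^d` such that (i) every one-hot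
function `f_z` is approximated in sup norm to accuracy `ε` by a linear function with
coefficient norm at most `1`, and (ii) for every deterministic adaptive strategy `A` there
is `z ∈ X` such that, in the run of `A` against `f_z`, none of the first `|X| − 1` actions
is `ε'`-optimal for `f_z`. -/
theorem stmt_4 (X : Type*) [Fintype X] [DecidableEq X] [Nonempty X]
    (hX : 2 ≤ Fintype.card X)
    (ε : ℝ) (hε : 0 < ε) (ε' : ℝ) (hε'0 : 0 ≤ ε') (hε'1 : ε' < 1)
    (d : ℕ) (hd : 8 * Real.log (Fintype.card X) / ε ^ 2 ≤ (d : ℝ)) :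
    ∃ φ : X → EuclideanSpace ℝ (Fin d),
      (∀ z : X, ∃ θ : EuclideanSpace ℝ (Fin d), ‖θ‖ ≤ 1 ∧
        ∀ x : X, |(if x = z then (1 : ℝ) else 0) - ⟪θ, φ x⟫| ≤ ε) ∧
      (∀ A : List ℝ → X, ∃ z : X,
        ∀ (x : ℕ → X) (y : ℕ → ℝ),
          (∀ k : ℕ, x k = A (List.ofFn (fun i : Fin k => y (i + 1)))) →
          (∀ k : ℕ, y (k + 1) = if x k = z then (1 : ℝ) else 0) →
          ∀ k < Fintype.card X - 1,
            ¬ ((if x k = z then (1 : ℝ) else 0) ≥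
                (Finset.univ.sup' Finset.univ_nonempty
                  (fun x' : X => if x' = z then (1 : ℝ) else 0)) - ε')) := by
  have hn : (2 : ℝ) ≤ Fintype.card X := by exact_mod_cast hX
  have hlog : 0 < Real.log (Fintype.card X) := Real.log_pos (by linarith)
  have hd₀ : 0 < d := by
    have : (0 : ℝ) < d := lt_of_lt_of_le (by positivity) hd
    exact_mod_cast this
  have hcard : 2 * (Fintype.card X : ℝ) ≤ Real.exp (d * ε ^ 2 / 2) := by
    rw [div_le_iff₀ (by positivity)] at hd
    calc 2 * (Fintype.card X : ℝ) ≤ Fintype.card X * Fintype.card X := by gcongr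
      _ = Real.exp (Real.log (Fintype.card X) + Real.log (Fintype.card X)) := by
        rw [Real.exp_add, Real.exp_log (by linarith)]
      _ ≤ Real.exp (d * ε ^ 2 / 2) := Real.exp_le_exp.2 (by linarith)
  obtain ⟨φ, hnorm, hφ⟩ := exists_almost_orthonormal (X := X) hd₀ hε.le hcard
  refine ⟨φ, fun z => ⟨φ z, (hnorm z).le, hφ z⟩, fun A => ?_⟩
  obtain ⟨z, hz⟩ := exists_missed_point A
  refine ⟨z, fun x y hx hy k hk hopt => ?_⟩
  rw [if_neg (hz x y hx hy k hk)] at hopt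
  have hsup : (1 : ℝ) ≤ Finset.univ.sup' Finset.univ_nonempty
      (fun x' : X => if x' = z then (1 : ℝ) else 0) :=
    Finset.le_sup'_of_le _ (Finset.mem_univ z) (by simp)
  linarith
end

section
/- Let d ≥ 1 and t ≥ 1 be natural numbers, let ε > 0, and let φ_0, …, φ_{t−1} ∈ ℝ^d satisfy ‖φ_τ‖₂ ≤ 1 for every τ < t. Set λ = ε²·t and, for each τ ≤ t, define the d×d matrix Ψ_τ = λ·I + Σ_{k<τ} φ_k φ_kᵀ. If φ_τᵀ Ψ_τ⁻¹ φ_τ ≥ 1/2 for every τ < t, then t ≤ 3d·log(1 + 1/(d·ε²)). -/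
open Matrix

/-- Matrix determinant lemma for a symmetric rank-one update. -/
lemma det_add_vecMulVec_self {n : Type*} [Fintype n] [DecidableEq n] {A : Matrix n n ℝ}
    (hA : IsUnit A.det) (v : n → ℝ) :
    (A + vecMulVec v v).det = A.det * (1 + v ⬝ᵥ (A⁻¹ *ᵥ v)) := by
  rw [vecMulVec_eq Unit, det_add_replicateCol_mul_replicateRow hA,
    det_unique (n := Unit), Matrix.add_apply, one_apply_eq, Matrix.mul_assoc, ← replicateCol_mulVec,
    replicateRow_mul_replicateCol_apply]

/-- AM-GM for the eigenvalues of a positive definite matrix, in logarithmic form. -/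
lemma log_det_le_card_mul_log {n : Type*} [Fintype n] [DecidableEq n] {A : Matrix n n ℝ}
    (hA : A.PosDef) {m : ℝ} (hm : 0 < m) (htr : A.trace ≤ Fintype.card n * m) :
    Real.log A.det ≤ Fintype.card n * Real.log m := by
  have hdet : A.det = ∏ i, hA.isHermitian.eigenvalues i := by
    simpa using hA.isHermitian.det_eq_prod_eigenvalues
  have htrace : A.trace = ∑ i, hA.isHermitian.eigenvalues i := by
    simpa using hA.isHermitian.trace_eq_sum_eigenvalues
  rw [hdet, Real.log_prod fun i _ => (hA.eigenvalues_pos i).ne']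
  calc ∑ i, Real.log (hA.isHermitian.eigenvalues i)
      ≤ ∑ i, (Real.log m + (hA.isHermitian.eigenvalues i / m - 1)) := by
        refine Finset.sum_le_sum fun i _ => ?_
        have hi := hA.eigenvalues_pos i
        have := Real.log_le_sub_one_of_pos (div_pos hi hm)
        rw [Real.log_div hi.ne' hm.ne'] at this
        linarith
    _ = Fintype.card n * Real.log m + (A.trace / m - Fintype.card n) := by
        simp [Finset.sum_add_distrib, htrace, Finset.sum_div]
    _ ≤ Fintype.card n * Real.log m := by
        have := (div_le_iff₀ hm).2 htr
        linarith

lemma posDef_smul_one_add_sum_vecMulVec {n ι : Type*} [Fintype n] [DecidableEq n] {r : ℝ}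
    (hr : 0 < r) (s : Finset ι) (φ : ι → n → ℝ) :
    (r • (1 : Matrix n n ℝ) + ∑ k ∈ s, vecMulVec (φ k) (φ k)).PosDef :=
  (PosDef.one.smul hr).add_posSemidef <| posSemidef_sum s fun k _ => by
    simpa using posSemidef_vecMulVec_self_star (φ k)

/-- Elliptic potential bound: let `φ_0, …, φ_{t−1} ∈ ℝ^d` have Euclidean norm at most `1`,
let `λ = ε² t`, and let `Ψ_τ = λ I + ∑_{k<τ} φ_k φ_kᵀ`. If `φ_τᵀ Ψ_τ⁻¹ φ_τ ≥ 1/2` for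
every `τ < t`, then `t ≤ 3 d log(1 + 1/(d ε²))`. -/
theorem stmt_6 (d t : ℕ) (hd : 1 ≤ d) (ht : 1 ≤ t) (ε : ℝ) (hε : 0 < ε)
    (φ : ℕ → Fin d → ℝ)
    (hnorm : ∀ τ < t, Real.sqrt (∑ i, (φ τ i) ^ 2) ≤ 1)
    (Ψ : ℕ → Matrix (Fin d) (Fin d) ℝ)
    (hΨ : ∀ τ, Ψ τ = (ε ^ 2 * t) • (1 : Matrix (Fin d) (Fin d) ℝ) +
        ∑ k ∈ Finset.range τ, vecMulVec (φ k) (φ k))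
    (hbig : ∀ τ < t, (1 : ℝ) / 2 ≤ φ τ ⬝ᵥ ((Ψ τ)⁻¹ *ᵥ φ τ)) :
    (t : ℝ) ≤ 3 * d * Real.log (1 + 1 / (d * ε ^ 2)) := by
  have hd0 : (0 : ℝ) < d := by exact_mod_cast hd
  have ht0 : (0 : ℝ) < t := by exact_mod_cast ht
  have hr : 0 < ε ^ 2 * t := by positivity
  have hpos : ∀ τ, (Ψ τ).PosDef := fun τ => by
    rw [hΨ]
    exact posDef_smul_one_add_sum_vecMulVec hr _ φ
  have hgrow : ∀ τ ≤ t, (ε ^ 2 * t) ^ d * (3 / 2) ^ τ ≤ (Ψ τ).det := by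
    intro τ
    induction τ with
    | zero => intro _; simp [hΨ]
    | succ τ ih =>
      intro hτ
      have hstep : Ψ (τ + 1) = Ψ τ + vecMulVec (φ τ) (φ τ) := by
        rw [hΨ, hΨ τ, Finset.sum_range_succ, add_assoc]
      rw [hstep, det_add_vecMulVec_self (hpos τ).det_pos.ne'.isUnit, pow_succ (3 / 2 : ℝ),
        ← mul_assoc]
      have := hbig τ hτ
      exact mul_le_mul (ih (by lia)) (by linarith) (by norm_num) (hpos τ).det_pos.le
  have htrace : (Ψ t).trace ≤ Fintype.card (Fin d) * (ε ^ 2 * t + t / d) := by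
    have hφ : ∑ k ∈ Finset.range t, φ k ⬝ᵥ φ k ≤ t := by
      calc ∑ k ∈ Finset.range t, φ k ⬝ᵥ φ k ≤ ∑ _k ∈ Finset.range t, (1 : ℝ) := by
            refine Finset.sum_le_sum fun k hk => ?_
            have := (Real.sqrt_le_iff.1 (hnorm k (Finset.mem_range.1 hk))).2
            simpa [dotProduct, ← sq] using this
        _ = t := by simp
    rw [hΨ, trace_add, trace_smul, trace_one, trace_sum]
    simp only [trace_vecMulVec, Fintype.card_fin, smul_eq_mul]
    have : (d : ℝ) * (ε ^ 2 * t + t / d) = ε ^ 2 * t * d + t := by field_simp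
    linarith
  have hupper := log_det_le_card_mul_log (hpos t) (by positivity) htrace
  have hlower := Real.log_le_log (by positivity) (hgrow t le_rfl)
  have hfactor : ε ^ 2 * t + t / d = ε ^ 2 * t * (1 + 1 / (d * ε ^ 2)) := by field_simp
  rw [Real.log_mul (by positivity) (by positivity), Real.log_pow, Real.log_pow] at hlower
  rw [hfactor, Real.log_mul hr.ne' (by positivity), Fintype.card_fin] at hupper
  have hlog : (1 : ℝ) / 3 ≤ Real.log (3 / 2) := by
    have := Real.one_sub_inv_le_log_of_pos (show (0 : ℝ) < 3 / 2 by norm_num)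
    norm_num at this ⊢
    exact this
  have := mul_le_mul_of_nonneg_left hlog ht0.le
  linarith
end

section
/- Let d ≥ 1 and t be natural numbers, let λ > 0, and let v_0, …, v_{t−1} ∈ ℝ^d. For each τ ≤ t define the d×d matrix Ψ_τ = λ·I + Σ_{k<τ} v_k v_kᵀ. If v_τᵀ Ψ_τ⁻¹ v_τ ≥ 1/2 for every τ < t, then det(Ψ_t) ≥ (3/2)^t · λ^d. -/
open Matrix

/-- The matrix determinant lemma for a rank-one update. -/
theorem det_add_vecMulVec_eq {n R : Type*} [Fintype n] [DecidableEq n] [CommRing R]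
    {A : Matrix n n R} (hA : IsUnit A.det) (u w : n → R) :
    (A + vecMulVec u w).det = (1 + w ⬝ᵥ (A⁻¹ *ᵥ u)) * A.det := by
  have h : A + vecMulVec u w =
      A * (1 + replicateCol Unit (A⁻¹ *ᵥ u) * replicateRow Unit w) := by
    rw [Matrix.mul_add, Matrix.mul_one, replicateCol_mulVec, ← Matrix.mul_assoc,
      mul_nonsing_inv_cancel_left _ _ hA, ← vecMulVec_eq]
  rw [h, det_mul, det_one_add_replicateCol_mul_replicateRow, mul_comm]

/-- Iterated matrix determinant lemma: with `Ψ_τ = λ I + ∑_{k<τ} v_k v_kᵀ` for `λ > 0`,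
if `v_τᵀ Ψ_τ⁻¹ v_τ ≥ 1/2` for every `τ < t`, then `det Ψ_t ≥ (3/2)^t λ^d`. -/
theorem stmt_7 (d t : ℕ) (hd : 1 ≤ d) (l : ℝ) (hl : 0 < l)
    (v : ℕ → Fin d → ℝ)
    (Ψ : ℕ → Matrix (Fin d) (Fin d) ℝ)
    (hΨ : ∀ τ, Ψ τ = l • (1 : Matrix (Fin d) (Fin d) ℝ) +
        ∑ k ∈ Finset.range τ, vecMulVec (v k) (v k))
    (hbig : ∀ τ < t, (1 : ℝ) / 2 ≤ v τ ⬝ᵥ ((Ψ τ)⁻¹ *ᵥ v τ)) :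
    (3 / 2 : ℝ) ^ t * l ^ d ≤ (Ψ t).det := by
  induction t with
  | zero => simp [hΨ]
  | succ t ih =>
    have h := ih fun τ hτ => hbig τ (hτ.trans t.lt_succ_self)
    have hpos : 0 < (Ψ t).det := lt_of_lt_of_le (by positivity) h
    have hstep : Ψ (t + 1) = Ψ t + vecMulVec (v t) (v t) := by
      rw [hΨ, hΨ, Finset.sum_range_succ, add_assoc]
    rw [hstep, det_add_vecMulVec_eq hpos.ne'.isUnit]
    calc (3 / 2 : ℝ) ^ (t + 1) * l ^ d = 3 / 2 * ((3 / 2) ^ t * l ^ d) := by ring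
      _ ≤ 3 / 2 * (Ψ t).det := by gcongr
      _ ≤ _ := by
        gcongr
        linarith [hbig t t.lt_succ_self]
end

section
/- Let d ≥ 1 and τ ≥ 1 be natural numbers, let ε > 0, let φ_0, …, φ_{τ−1} ∈ ℝ^d, and let φ ∈ ℝ^d. Define Φ = Σ_{k<τ} φ_k φ_kᵀ and Ψ = Φ + ε²·τ·I. If θ, θ' ∈ ℝ^d satisfy ‖θ‖₂ ≤ 1, ‖θ'‖₂ ≤ 1, and Σ_{k<τ} (⟨θ − θ', φ_k⟩)² ≤ 4ε²τ, then ⟨θ − θ', φ⟩ ≤ √(8 ε² τ · φᵀΨ⁻¹φ). -/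
open Matrix

namespace Matrix

variable {n : Type*} [Fintype n] [DecidableEq n]

/-- Cauchy–Schwarz for the bilinear form of a real positive semidefinite matrix. -/
theorem PosSemidef.sq_dotProduct_mulVec_le {M : Matrix n n ℝ} (hM : M.PosSemidef)
    (x y : n → ℝ) : (x ⬝ᵥ M *ᵥ y) ^ 2 ≤ (x ⬝ᵥ M *ᵥ x) * (y ⬝ᵥ M *ᵥ y) := by
  have hsymm : y ⬝ᵥ M *ᵥ x = x ⬝ᵥ M *ᵥ y := by
    rw [dotProduct_mulVec, ← mulVec_transpose, ← conjTranspose_eq_transpose_of_trivial,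
      hM.isHermitian.eq, dotProduct_comm]
  have h := LinearMap.BilinForm.apply_mul_apply_le_of_forall_zero_le (toBilin' M)
    (fun z => by simpa [toBilin'_apply'] using hM.dotProduct_mulVec_nonneg z) x y
  simpa only [toBilin'_apply', hsymm, ← sq] using h

/-- The width of an ellipsoid `{x | xᵀ M x ≤ c}` in the direction `y`. -/
theorem PosDef.dotProduct_le_sqrt {M : Matrix n n ℝ} (hM : M.PosDef) {c : ℝ} {x : n → ℝ}
    (hx : x ⬝ᵥ M *ᵥ x ≤ c) (y : n → ℝ) : x ⬝ᵥ y ≤ Real.sqrt (c * (y ⬝ᵥ M⁻¹ *ᵥ y)) := by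
  have hy : M *ᵥ (M⁻¹ *ᵥ y) = y := by
    rw [mulVec_mulVec, mul_nonsing_inv _ ((isUnit_iff_isUnit_det M).mp hM.isUnit), one_mulVec]
  have hcs := hM.posSemidef.sq_dotProduct_mulVec_le x (M⁻¹ *ᵥ y)
  rw [hy, dotProduct_comm (M⁻¹ *ᵥ y) y] at hcs
  have hinv : 0 ≤ y ⬝ᵥ M⁻¹ *ᵥ y := by
    simpa using hM.inv.posSemidef.dotProduct_mulVec_nonneg y
  exact Real.le_sqrt_of_sq_le (hcs.trans (mul_le_mul_of_nonneg_right hx hinv))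

variable {ι : Type*} (s : Finset ι) (v : ι → n → ℝ)

theorem posDef_sum_vecMulVec_add_smul_one {c : ℝ} (hc : 0 < c) :
    (∑ k ∈ s, vecMulVec (v k) (v k) + c • (1 : Matrix n n ℝ)).PosDef :=
  PosDef.posSemidef_add
    (posSemidef_sum s fun k _ => by simpa using posSemidef_vecMulVec_self_star (v k))
    (PosDef.one.smul hc)

theorem dotProduct_sum_vecMulVec_add_smul_one_mulVec (c : ℝ) (x : n → ℝ) :
    x ⬝ᵥ (∑ k ∈ s, vecMulVec (v k) (v k) + c • (1 : Matrix n n ℝ)) *ᵥ x =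
      ∑ k ∈ s, (x ⬝ᵥ v k) ^ 2 + c * (x ⬝ᵥ x) := by
  simp [add_mulVec, sum_mulVec, dotProduct_sum, vecMulVec_mulVec, smul_mulVec,
    dotProduct_comm _ x, sq]

end Matrix

theorem dotProduct_sub_self_le_four {n : Type*} [Fintype n] {x y : n → ℝ}
    (hx : Real.sqrt (∑ i, x i ^ 2) ≤ 1) (hy : Real.sqrt (∑ i, y i ^ 2) ≤ 1) :
    (x - y) ⬝ᵥ (x - y) ≤ 4 := by
  rw [Real.sqrt_le_one] at hx hy
  calc (x - y) ⬝ᵥ (x - y) ≤ ∑ i, (2 * x i ^ 2 + 2 * y i ^ 2) :=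
        Finset.sum_le_sum fun i _ => by
          simp only [Pi.sub_apply]
          nlinarith [sq_nonneg (x i + y i)]
    _ = 2 * ∑ i, x i ^ 2 + 2 * ∑ i, y i ^ 2 := by
        rw [Finset.sum_add_distrib, Finset.mul_sum, Finset.mul_sum]
    _ ≤ 4 := by linarith

/-- Confidence-width bound: with `Φ = ∑_{k<τ} φ_k φ_kᵀ` and `Ψ = Φ + ε² τ I`, if
`θ, θ'` have Euclidean norm at most `1` and `∑_{k<τ} ⟨θ − θ', φ_k⟩² ≤ 4 ε² τ`, then
`⟨θ − θ', φ⟩ ≤ √(8 ε² τ · φᵀ Ψ⁻¹ φ)`. -/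
theorem stmt_11 (d τ : ℕ) (hd : 1 ≤ d) (hτ : 1 ≤ τ) (ε : ℝ) (hε : 0 < ε)
    (φk : ℕ → Fin d → ℝ) (φ : Fin d → ℝ)
    (Ψ : Matrix (Fin d) (Fin d) ℝ)
    (hΨ : Ψ = (∑ k ∈ Finset.range τ, vecMulVec (φk k) (φk k)) +
        (ε ^ 2 * τ) • (1 : Matrix (Fin d) (Fin d) ℝ))
    (θ θ' : Fin d → ℝ)
    (hθ : Real.sqrt (∑ i, (θ i) ^ 2) ≤ 1)
    (hθ' : Real.sqrt (∑ i, (θ' i) ^ 2) ≤ 1)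
    (hsum : ∑ k ∈ Finset.range τ, ((θ - θ') ⬝ᵥ φk k) ^ 2 ≤ 4 * ε ^ 2 * τ) :
    (θ - θ') ⬝ᵥ φ ≤ Real.sqrt (8 * ε ^ 2 * τ * (φ ⬝ᵥ (Ψ⁻¹ *ᵥ φ))) := by
  have hc : 0 < ε ^ 2 * τ := mul_pos (pow_pos hε 2) (Nat.cast_pos.mpr hτ)
  subst hΨ
  refine (posDef_sum_vecMulVec_add_smul_one _ φk hc).dotProduct_le_sqrt ?_ φ
  rw [dotProduct_sum_vecMulVec_add_smul_one_mulVec]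
  nlinarith [mul_le_mul_of_nonneg_left (dotProduct_sub_self_le_four hθ hθ') hc.le]
end
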